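/- Let U ⊆ ℝ^N be a nonempty open set, Γ a flat formal connection on U, and c_1, c_2 : [0,1] → U continuous piecewise C^∞ paths with the same initial point p and the same final point q. Suppose there is an open set U' ⊆ U containing all values of c_1 and c_2 which is star-shaped around some point ϖ ∈ U' (i.e. (1−t)x + tϖ ∈ U' for all x ∈ U' and t ∈ [0,1]). Then the parallel transports from p to q along c_1 and along c_2 coincide. In particular, the parallel transport along any continuous piecewise C^∞ loop contained in U' equals 1 ∈ 𝒜[[λ]]. -/

import Mathlib

open Set Filter MeasureTheory

universe u

/-- Piecewise `C^∞` functions on `[a,b]` with singular set `D`: smooth off `D`,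
and all one-sided limits of all iterated derivatives exist at the points of `D`. -/
def PWSm (a b : ℝ) (D : Set ℝ) {E : Type*} [NormedAddCommGroup E] [NormedSpace ℝ E]
    (f : ℝ → E) : Prop :=
  ContDiffOn ℝ (⊤ : ℕ∞) f (Set.Icc a b \ D) ∧
  ∀ r : ℕ, ∀ d ∈ D,
    (∃ L : E, Filter.Tendsto (iteratedDerivWithin r f (Set.Icc a b \ D))
      (nhdsWithin d ((Set.Icc a b \ D) ∩ Set.Iio d)) (nhds L)) ∧
    (∃ L : E, Filter.Tendsto (iteratedDerivWithin r f (Set.Icc a b \ D))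
      (nhdsWithin d ((Set.Icc a b \ D) ∩ Set.Ioi d)) (nhds L))

section

variable {𝒜 : Type u} [Ring 𝒜] [Algebra ℂ 𝒜]

/-- An element of `C^∞_D([a,b],ℂ) ⊗ 𝒜`: a finite sum of piecewise smooth complex
functions tensored with algebra elements. -/
def PWTensor (a b : ℝ) (D : Set ℝ) (g : ℝ → 𝒜) : Prop :=
  ∃ (n : ℕ) (f : Fin n → ℝ → ℂ) (v : Fin n → 𝒜),
    (∀ i, PWSm a b D (f i)) ∧ ∀ s, g s = ∑ i, f i s • v i

/-- An element of `C^∞_D([a,b],ℂ)^0 ⊗ 𝒜`: as `PWTensor` but with the complex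
coefficient functions extending continuously to `[a,b]`. -/
def PWTensor0 (a b : ℝ) (D : Set ℝ) (g : ℝ → 𝒜) : Prop :=
  ∃ (n : ℕ) (f : Fin n → ℝ → ℂ) (v : Fin n → 𝒜),
    (∀ i, PWSm a b D (f i) ∧ ContinuousOn (f i) (Set.Icc a b)) ∧
    ∀ s, g s = ∑ i, f i s • v i

/-- `G` is (on `[a,b]`) the primitive of `g` normalized at `α`, computed via any finite
tensor representation of `g`. -/
def HasPrimitiveOn (a b α : ℝ) (g G : ℝ → 𝒜) : Prop :=
  ∃ (n : ℕ) (f : Fin n → ℝ → ℂ) (v : Fin n → 𝒜),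
    (∀ i, ∀ s ∈ Set.Icc a b, IntervalIntegrable (f i) MeasureTheory.volume α s) ∧
    (∀ s, g s = ∑ i, f i s • v i) ∧
    ∀ s ∈ Set.Icc a b, G s = ∑ i, (∫ t in α..s, f i t) • v i

/-- `ω` is a (continuous, piecewise smooth) solution of the formal linear ODE
`dω/ds = λ Y ω`, `ω(α) = init`, written coefficientwise in `λ` in integral form:
`ω = init + λ I_α(Y ω)`. -/
def IsFundSol (a b α : ℝ) (D : Set ℝ) (Y : ℕ → ℝ → 𝒜) (init : ℕ → 𝒜)
    (ω : ℕ → ℝ → 𝒜) : Prop :=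
  (∀ r, PWTensor0 a b D (ω r)) ∧
  (∀ s ∈ Set.Icc a b, ω 0 s = init 0) ∧
  ∀ r : ℕ, ∃ G : ℝ → 𝒜,
    HasPrimitiveOn a b α (fun t => ∑ u ∈ Finset.range (r + 1), Y u t * ω (r - u) t) G ∧
    ∀ s ∈ Set.Icc a b, ω (r + 1) s = init (r + 1) + G s

end

section

variable {𝒜 : Type u} [Ring 𝒜] [Algebra ℂ 𝒜] {N : ℕ}

/-- The value of `ω` at the point `s`, as a formal power series in `𝒜[[λ]]`. -/
noncomputable def seriesAt (ω : ℕ → ℝ → 𝒜) (s : ℝ) : PowerSeries 𝒜 :=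
  PowerSeries.mk fun r => ω r s

/-- The unit `1 ∈ 𝒜[[λ]]` as a sequence of coefficients. -/
def onePS : ℕ → 𝒜 := fun r => if r = 0 then (1 : 𝒜) else 0

/-- A finite sum of smooth complex functions on `U` tensored with elements of `𝒜`. -/
def ConnTensor (U : Set (Fin N → ℝ)) (g : (Fin N → ℝ) → 𝒜) : Prop :=
  ∃ (n : ℕ) (f : Fin n → (Fin N → ℝ) → ℂ) (v : Fin n → 𝒜),
    (∀ i, ContDiffOn ℝ (⊤ : ℕ∞) (f i) U) ∧ ∀ x, g x = ∑ i, f i x • v i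

/-- A formal connection `Γ` on `U ⊆ ℝ^N`: the components `Γ_i` are elements of
`(C^∞(U,ℂ) ⊗ 𝒜)[[λ]]`. -/
def IsFormalConn (U : Set (Fin N → ℝ)) (Γ : Fin N → ℕ → (Fin N → ℝ) → 𝒜) : Prop :=
  ∀ i r, ConnTensor U (Γ i r)

/-- A continuous piecewise `C^∞` path with singular set `D`. -/
def PWPath (a b : ℝ) (D : Set ℝ) (c : ℝ → Fin N → ℝ) : Prop :=
  ContinuousOn c (Set.Icc a b) ∧ ∀ i, PWSm a b D (fun s => c s i)

/-- `Γ^{(c)} = Σ_i (Γ_i ∘ c) dc_i/ds`, the coefficient of the formal linear ODE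
associated to the connection `Γ` and the path `c`. -/
noncomputable def pathField (Γ : Fin N → ℕ → (Fin N → ℝ) → 𝒜) (c : ℝ → Fin N → ℝ)
    (r : ℕ) (s : ℝ) : 𝒜 :=
  ∑ i, ((deriv (fun t => c t i) s : ℝ) : ℂ) • Γ i r (c s)

end

section

variable {𝒜 : Type u} [Ring 𝒜] [Algebra ℂ 𝒜] {N : ℕ}

/-- `h = ∂g/∂x_j` on `U`, computed through a finite tensor representation of `g`. -/
def PartialOf (U : Set (Fin N → ℝ)) (g : (Fin N → ℝ) → 𝒜) (j : Fin N)
    (h : (Fin N → ℝ) → 𝒜) : Prop :=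
  ∃ (n : ℕ) (f : Fin n → (Fin N → ℝ) → ℂ) (v : Fin n → 𝒜),
    (∀ k, ContDiffOn ℝ (⊤ : ℕ∞) (f k) U) ∧ (∀ x, g x = ∑ k, f k x • v k) ∧
    ∀ x ∈ U, h x = ∑ k, (fderiv ℝ (f k) x (Pi.single j 1)) • v k

/-- Formal flatness of `Γ` on `U`:
`∂Γ_i/∂x_j − ∂Γ_j/∂x_i + λ(Γ_iΓ_j − Γ_jΓ_i) = 0`, coefficientwise in `λ`. -/
def IsFlat (U : Set (Fin N → ℝ)) (Γ : Fin N → ℕ → (Fin N → ℝ) → 𝒜) : Prop :=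
  ∃ dΓ : Fin N → Fin N → ℕ → (Fin N → ℝ) → 𝒜,
    (∀ j i r, PartialOf U (Γ i r) j (dΓ j i r)) ∧
    (∀ i j : Fin N, ∀ x ∈ U, dΓ j i 0 x - dΓ i j 0 x = 0) ∧
    ∀ i j : Fin N, ∀ r : ℕ, ∀ x ∈ U,
      dΓ j i (r + 1) x - dΓ i j (r + 1) x +
        ∑ u ∈ Finset.range (r + 1),
          (Γ i u x * Γ j (r - u) x - Γ j u x * Γ i (r - u) x) = 0

end

section FlatFrame

open scoped Topology

variable {𝒜 : Type u} [Ring 𝒜] [Algebra ℂ 𝒜] {N : ℕ}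

/-- The complex-valued constant-coefficient 1-form `Σ_i a_i dx_i` on `ℝ^N`. -/
noncomputable def coordForm : (Fin N → ℂ) →L[ℝ] (Fin N → ℝ) →L[ℝ] ℂ :=
  ∑ i, (ContinuousLinearMap.smulRightL ℝ (Fin N → ℝ) ℂ (ContinuousLinearMap.proj i)) ∘L
    (ContinuousLinearMap.proj i)

theorem coordForm_apply (a : Fin N → ℂ) (v : Fin N → ℝ) :
    coordForm a v = ∑ i, v i • a i := by
  simp [coordForm]

theorem coordForm_apply_single (a : Fin N → ℂ) (j : Fin N) :
    coordForm a (Pi.single j 1) = a j := by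
  simp [coordForm_apply, Pi.single_apply]

theorem coordForm_fderiv_single (T : (Fin N → ℝ) →L[ℝ] ℂ) :
    coordForm (fun i => T (Pi.single i 1)) = T := by
  ext v
  rw [coordForm_apply]
  conv_rhs => rw [pi_eq_sum_univ' v]
  simp [map_sum]

/-- A closed 1-form on a star-shaped open set is exact. -/
theorem StarConvex.exists_forall_hasFDerivAt_of_symmetric {E F : Type*}
    [NormedAddCommGroup E] [NormedSpace ℝ E] [NormedAddCommGroup F] [NormedSpace ℝ F]
    [CompleteSpace F] {s : Set E} {p : E} (hs : StarConvex ℝ p s) (hso : IsOpen s)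
    {ω : E → E →L[ℝ] F} {dω : E → E →L[ℝ] E →L[ℝ] F}
    (hω : ∀ x ∈ s, HasFDerivAt ω (dω x) x)
    (hdω : ∀ x ∈ s, ∀ u v, dω x u v = dω x v u) :
    ∃ f : E → F, ∀ x ∈ s, HasFDerivAt f (ω x) x := by
  refine ⟨fun y => curveIntegral ω (Path.segment p y), fun x hx => ?_⟩
  obtain ⟨ε, hε, hball⟩ := Metric.isOpen_iff.1 hso x hx
  have hmain : HasFDerivAt
      (fun y => curveIntegral ω (Path.segment p x) + curveIntegral ω (Path.segment x y))
      (ω x) x := by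
    refine HasFDerivAt.const_add _ (HasFDerivAt.curveIntegral_segment_source' ?_)
    filter_upwards [hso.mem_nhds hx] with z hz using (hω z hz).continuousAt
  refine hmain.congr_of_eventuallyEq ?_
  filter_upwards [Metric.ball_mem_nhds x hε] with y hy
  have hsub : convexHull ℝ {p, x, y} ⊆ s := by
    rw [convexHull_insert (by simp), convexHull_pair]
    intro w hw
    obtain ⟨q, hq, z, hz, hwz⟩ := mem_convexJoin.1 hw
    rw [Set.mem_singleton_iff] at hq
    subst hq
    have hzs : z ∈ s :=
      hball ((convex_ball x ε).segment_subset (Metric.mem_ball_self hε) hy hz)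
    exact hs.segment_subset hzs hwz
  symm
  exact (convex_convexHull ℝ {p, x, y}).curveIntegral_segment_add_eq_of_hasFDerivWithinAt_symmetric
    (fun z hz => (hω z (hsub hz)).hasFDerivWithinAt) (fun z hz u _ v _ => hdω z (hsub hz) u v)
    (subset_convexHull ℝ _ (by simp)) (subset_convexHull ℝ _ (by simp))
    (subset_convexHull ℝ _ (by simp))

/-- `g` takes values in a finitely generated subspace of `𝒜`. -/
def FiniteSpan {X : Type*} (g : X → 𝒜) : Prop :=
  ∃ V : Submodule ℂ 𝒜, V.FG ∧ ∀ x, g x ∈ V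

theorem FiniteSpan.mul {X : Type*} {g h : X → 𝒜} (hg : FiniteSpan g) (hh : FiniteSpan h) :
    FiniteSpan fun x => g x * h x := by
  obtain ⟨V, hV, hgV⟩ := hg
  obtain ⟨W, hW, hhW⟩ := hh
  exact ⟨V * W, hV.mul hW, fun x => Submodule.mul_mem_mul (hgV x) (hhW x)⟩

theorem FiniteSpan.sum {X ι : Type*} {s : Finset ι} {g : ι → X → 𝒜}
    (hg : ∀ i ∈ s, FiniteSpan (g i)) : FiniteSpan fun x => ∑ i ∈ s, g i x := by
  choose! V hV hgV using hg
  refine ⟨⨆ i ∈ s, V i, Submodule.fg_biSup s V hV, fun x => Submodule.sum_mem _ fun i hi => ?_⟩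
  exact (le_biSup V hi) (hgV i hi x)

theorem finiteSpan_sum_smul {X : Type*} {n : ℕ} (f : Fin n → X → ℂ) (v : Fin n → 𝒜) :
    FiniteSpan fun x => ∑ k, f k x • v k :=
  ⟨Submodule.span ℂ (Set.range v), Submodule.fg_span (Set.finite_range v), fun _ =>
    Submodule.sum_mem _ fun k _ => Submodule.smul_mem _ _ (Submodule.subset_span ⟨k, rfl⟩)⟩

/-- A finitely generated subspace is recovered by finitely many functionals. -/
theorem Submodule.FG.exists_dual_repr {V : Submodule ℂ 𝒜} (hV : V.FG) :
    ∃ (n : ℕ) (α : Fin n → Module.Dual ℂ 𝒜) (v : Fin n → 𝒜),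
      ∀ a ∈ V, a = ∑ k, α k a • v k := by
  have : Module.Finite ℂ V := Module.Finite.iff_fg.2 hV
  obtain ⟨P, hP⟩ := LinearMap.exists_leftInverse_of_injective V.subtype (Submodule.ker_subtype V)
  let b := Module.finBasis ℂ V
  refine ⟨_, fun k => b.coord k ∘ₗ P, fun k => (b k : 𝒜), fun a ha => ?_⟩
  have hPa : P a = ⟨a, ha⟩ := LinearMap.congr_fun hP ⟨a, ha⟩
  have h := congrArg V.subtype (b.sum_repr ⟨a, ha⟩)
  rw [map_sum] at h
  simp only [LinearMap.comp_apply, hPa]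
  exact h.symm

theorem eq_of_forall_dual {a b : 𝒜} (h : ∀ φ : Module.Dual ℂ 𝒜, φ a = φ b) : a = b := by
  rw [← sub_eq_zero, ← Module.forall_dual_apply_eq_zero_iff ℂ]
  intro φ
  simp [h φ]

/-- `g` has the given partial derivatives at `x`, tested against all linear functionals of `𝒜`. -/
def HasWeakFDerivAt (g : (Fin N → ℝ) → 𝒜) (g' : Fin N → 𝒜) (x : Fin N → ℝ) : Prop :=
  ∀ φ : Module.Dual ℂ 𝒜, HasFDerivAt (fun y => φ (g y)) (coordForm fun i => φ (g' i)) x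

theorem hasWeakFDerivAt_const (a : 𝒜) (x : Fin N → ℝ) :
    HasWeakFDerivAt (fun _ => a) (fun _ => 0) x := by
  intro φ
  have h : (coordForm fun _ : Fin N => φ (0 : 𝒜)) = 0 := by
    ext v
    simp [coordForm_apply]
  rw [h]
  exact hasFDerivAt_const _ _

theorem HasWeakFDerivAt.sum {ι : Type*} {s : Finset ι} {g : ι → (Fin N → ℝ) → 𝒜}
    {g' : ι → Fin N → 𝒜} {x : Fin N → ℝ} (h : ∀ k ∈ s, HasWeakFDerivAt (g k) (g' k) x) :
    HasWeakFDerivAt (fun y => ∑ k ∈ s, g k y) (fun i => ∑ k ∈ s, g' k i) x := by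
  intro φ
  have hsum : (coordForm fun i => φ (∑ k ∈ s, g' k i)) =
      ∑ k ∈ s, coordForm fun i => φ (g' k i) := by
    rw [← map_sum]
    congr 1
    ext i
    simp
  rw [hsum]
  simp only [map_sum]
  exact HasFDerivAt.fun_sum fun k hk => h k hk φ

theorem PartialOf.hasWeakFDerivAt {U : Set (Fin N → ℝ)} (hU : IsOpen U)
    {g : (Fin N → ℝ) → 𝒜} {h : Fin N → (Fin N → ℝ) → 𝒜} (hg : ∀ j, PartialOf U g j (h j))
    {x : Fin N → ℝ} (hx : x ∈ U) : HasWeakFDerivAt g (fun j => h j x) x := by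
  intro φ
  have key : ∀ j, DifferentiableAt ℝ (fun y => φ (g y)) x ∧
      fderiv ℝ (fun y => φ (g y)) x (Pi.single j 1) = φ (h j x) := by
    intro j
    obtain ⟨n, f, v, hf, hgf, hh⟩ := hg j
    have hd : HasFDerivAt (fun y => φ (g y)) (∑ k, φ (v k) • fderiv ℝ (f k) x) x := by
      have : (fun y => φ (g y)) = fun y => ∑ k, φ (v k) * f k y := by
        ext y
        simp [hgf, mul_comm]
      rw [this]
      refine HasFDerivAt.fun_sum fun k _ => ?_
      exact (((hf k).contDiffAt (hU.mem_nhds hx)).differentiableAt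
        (by simp)).hasFDerivAt.const_mul _
    refine ⟨hd.differentiableAt, ?_⟩
    rw [hd.fderiv, hh x hx]
    simp [mul_comm]
  rcases isEmpty_or_nonempty (Fin N) with hN | ⟨⟨j⟩⟩
  · have : Subsingleton (Fin N → ℝ) := inferInstance
    exact hasFDerivAt_of_subsingleton _ _ |>.congr_fderiv (by ext v; simp [coordForm_apply])
  · have := (key j).1.hasFDerivAt
    rw [← coordForm_fderiv_single (fderiv ℝ _ x)] at this
    simpa only [fun j => (key j).2] using this

/-- The weak derivative of a finite-span function stays in the span. -/
theorem HasWeakFDerivAt.eq_sum {g : (Fin N → ℝ) → 𝒜} {g' : Fin N → 𝒜} {x : Fin N → ℝ}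
    (h : HasWeakFDerivAt g g' x) {n : ℕ} {α : Fin n → Module.Dual ℂ 𝒜} {v : Fin n → 𝒜}
    (hg : ∀ y, g y = ∑ k, α k (g y) • v k) (i : Fin N) :
    g' i = ∑ k, α k (g' i) • v k := by
  refine eq_of_forall_dual fun φ => ?_
  have h1 : HasFDerivAt (fun y => φ (g y))
      (∑ k, φ (v k) • coordForm fun i => α k (g' i)) x := by
    have : (fun y => φ (g y)) = fun y => ∑ k, φ (v k) * α k (g y) := by
      ext y
      conv_lhs => rw [hg]
      simp [mul_comm]
    rw [this]
    exact HasFDerivAt.fun_sum fun k _ => (h (α k)).const_mul _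
  have h2 := DFunLike.congr_fun ((h φ).unique h1) (Pi.single i 1)
  rw [coordForm_apply_single] at h2
  rw [h2]
  simp [coordForm_apply_single, mul_comm]

theorem HasWeakFDerivAt.mul {g h : (Fin N → ℝ) → 𝒜} {g' h' : Fin N → 𝒜} {x : Fin N → ℝ}
    (hg : HasWeakFDerivAt g g' x) (hh : HasWeakFDerivAt h h' x)
    (hgs : FiniteSpan g) (hhs : FiniteSpan h) :
    HasWeakFDerivAt (fun y => g y * h y) (fun i => g' i * h x + g x * h' i) x := by
  obtain ⟨V, hV, hgV⟩ := hgs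
  obtain ⟨W, hW, hhW⟩ := hhs
  obtain ⟨n, α, v, hα⟩ := hV.exists_dual_repr
  obtain ⟨m, β, w, hβ⟩ := hW.exists_dual_repr
  have hgr : ∀ y, g y = ∑ k, α k (g y) • v k := fun y => hα _ (hgV y)
  have hhr : ∀ y, h y = ∑ l, β l (h y) • w l := fun y => hβ _ (hhW y)
  have hmul : ∀ (φ : Module.Dual ℂ 𝒜) (a b : 𝒜), a = ∑ k, α k a • v k →
      b = ∑ l, β l b • w l →
      φ (a * b) = ∑ k, ∑ l, φ (v k * w l) * (α k a * β l b) := by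
    intro φ a b ha hb
    conv_lhs => rw [ha, hb]
    rw [Finset.sum_mul_sum]
    simp only [map_sum, smul_mul_smul_comm, map_smul, smul_eq_mul]
    exact Finset.sum_congr rfl fun k _ => Finset.sum_congr rfl fun l _ => mul_comm _ _
  intro φ
  have h1 : HasFDerivAt (fun y => φ (g y * h y))
      (∑ k, ∑ l, φ (v k * w l) • (α k (g x) • (coordForm fun i => β l (h' i)) +
        β l (h x) • coordForm fun i => α k (g' i))) x := by
    have : (fun y => φ (g y * h y)) =
        fun y => ∑ k, ∑ l, φ (v k * w l) * (α k (g y) * β l (h y)) := by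
      ext y
      exact hmul φ _ _ (hgr y) (hhr y)
    rw [this]
    exact HasFDerivAt.fun_sum fun k _ => HasFDerivAt.fun_sum fun l _ =>
      ((hg (α k)).mul (hh (β l))).const_mul _
  convert h1 using 1
  rw [← coordForm_fderiv_single (∑ k, _)]
  congr 1
  ext i
  simp only [sum_apply, smul_apply, add_apply, coordForm_apply_single, smul_eq_mul, map_add]
  rw [hmul φ _ _ (hg.eq_sum hgr i) (hhr x), hmul φ _ _ (hgr x) (hh.eq_sum hhr i)]
  simp only [← Finset.sum_add_distrib]
  exact Finset.sum_congr rfl fun k _ => Finset.sum_congr rfl fun l _ => by ring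

/-- Poincaré lemma for `𝒜`-valued 1-forms of finite span on a star-shaped open set. -/
theorem exists_hasWeakFDerivAt_of_symmetric {s : Set (Fin N → ℝ)} {p : Fin N → ℝ}
    (hs : StarConvex ℝ p s) (hso : IsOpen s) {A : Fin N → (Fin N → ℝ) → 𝒜}
    {B : Fin N → Fin N → (Fin N → ℝ) → 𝒜} (hA : ∀ i, FiniteSpan (A i))
    (hB : ∀ i, ∀ x ∈ s, HasWeakFDerivAt (A i) (fun j => B i j x) x)
    (hsymm : ∀ i j, ∀ x ∈ s, B i j x = B j i x) :
    ∃ P : (Fin N → ℝ) → 𝒜, FiniteSpan P ∧ ∀ x ∈ s, HasWeakFDerivAt P (fun i => A i x) x := by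
  choose V hV hAV using hA
  obtain ⟨n, α, v, hα⟩ := (Submodule.fg_iSup V hV).exists_dual_repr
  have hAr : ∀ i x, A i x = ∑ k, α k (A i x) • v k := fun i x =>
    hα _ (le_iSup V i (hAV i x))
  have hex : ∀ k, ∃ f : (Fin N → ℝ) → ℂ, ∀ x ∈ s,
      HasFDerivAt f (coordForm fun i => α k (A i x)) x := by
    intro k
    refine hs.exists_forall_hasFDerivAt_of_symmetric hso
      (dω := fun x => coordForm ∘L ContinuousLinearMap.pi fun i =>
        coordForm fun j => α k (B i j x)) (fun x hx => ?_) (fun x hx u w => ?_)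
    · exact coordForm.hasFDerivAt.comp x (hasFDerivAt_pi.2 fun i => hB i x hx (α k))
    · simp only [ContinuousLinearMap.comp_apply, coordForm_apply, ContinuousLinearMap.pi_apply,
        Finset.smul_sum]
      rw [Finset.sum_comm]
      refine Finset.sum_congr rfl fun j _ => Finset.sum_congr rfl fun i _ => ?_
      rw [hsymm i j x hx, smul_comm]
  choose f hf using hex
  refine ⟨fun x => ∑ k, f k x • v k, finiteSpan_sum_smul f v, fun x hx φ => ?_⟩
  have h1 : HasFDerivAt (fun y => φ (∑ k, f k y • v k))
      (∑ k, φ (v k) • coordForm fun i => α k (A i x)) x := by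
    have : (fun y => φ (∑ k, f k y • v k)) = fun y => ∑ k, φ (v k) * f k y := by
      ext y
      simp [mul_comm]
    rw [this]
    exact HasFDerivAt.fun_sum fun k _ => (hf k x hx).const_mul _
  convert h1 using 1
  rw [← coordForm_fderiv_single (∑ k, _)]
  congr 1
  ext i
  refine (congrArg φ (hAr i x)).trans ?_
  simp [coordForm_apply_single, mul_comm]

theorem PowerSeries.coeff_mk_mul_mk {R : Type*} [Semiring R] (a b : ℕ → R) (r : ℕ) :
    PowerSeries.coeff r (PowerSeries.mk a * PowerSeries.mk b) =
      ∑ u ∈ Finset.range (r + 1), a u * b (r - u) := by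
  rw [PowerSeries.coeff_mul, Finset.Nat.sum_antidiagonal_eq_sum_range_succ_mk]
  simp

open Classical in
/-- A finite-span primitive of `Σ_i A_i dx_i` on `s`, if there is one. -/
noncomputable def weakPrimitive (s : Set (Fin N → ℝ)) (A : Fin N → (Fin N → ℝ) → 𝒜) :
    (Fin N → ℝ) → 𝒜 :=
  if h : ∃ P : (Fin N → ℝ) → 𝒜,
      FiniteSpan P ∧ ∀ x ∈ s, HasWeakFDerivAt P (fun i => A i x) x then h.choose else 0

theorem weakPrimitive_spec {s : Set (Fin N → ℝ)} {A : Fin N → (Fin N → ℝ) → 𝒜}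
    (h : ∃ P : (Fin N → ℝ) → 𝒜,
      FiniteSpan P ∧ ∀ x ∈ s, HasWeakFDerivAt P (fun i => A i x) x) :
    FiniteSpan (weakPrimitive s A) ∧
      ∀ x ∈ s, HasWeakFDerivAt (weakPrimitive s A) (fun i => A i x) x := by
  rw [weakPrimitive, dif_pos h]
  exact h.choose_spec

/-- The coefficients of a solution `F` of `∂_i F = λ Γ_i F`, `F = 1 + O(λ)` on `s`. -/
noncomputable def flatFrame (s : Set (Fin N → ℝ)) (Γ : Fin N → ℕ → (Fin N → ℝ) → 𝒜) :
    ℕ → (Fin N → ℝ) → 𝒜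
  | 0 => fun _ => 1
  | r + 1 => weakPrimitive s fun i x =>
      ∑ u : Fin (r + 1), Γ i u x * flatFrame s Γ (r - u) x

/-- The curvature identity behind the integrability of `∂_i F = λ Γ_i F`. -/
theorem flat_series_symm {R : Type*} [Ring R] (G H K L F : PowerSeries R)
    (h : K - L + PowerSeries.X * (G * H - H * G) = 0) :
    K * F + G * (PowerSeries.X * (H * F)) = L * F + H * (PowerSeries.X * (G * F)) := by
  have hX : ∀ P : PowerSeries R, P * PowerSeries.X = PowerSeries.X * P :=
    fun P => PowerSeries.commute_X P
  have h' := congrArg (· * F) h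
  simp only [add_mul, sub_mul, mul_sub, zero_mul] at h'
  rw [← sub_eq_zero, ← h', ← mul_assoc G, hX G, ← mul_assoc H, hX H]
  noncomm_ring

/-- A flat formal connection has a frame of flat sections on star-shaped open sets. -/
theorem hasWeakFDerivAt_flatFrame {U s : Set (Fin N → ℝ)} (hU : IsOpen U) (hsU : s ⊆ U)
    (hso : IsOpen s) {p : Fin N → ℝ} (hs : StarConvex ℝ p s)
    {Γ : Fin N → ℕ → (Fin N → ℝ) → 𝒜} (hΓ : IsFormalConn U Γ) (hflat : IsFlat U Γ) (r : ℕ) :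
    FiniteSpan (flatFrame s Γ r) ∧ ∀ x ∈ s, HasWeakFDerivAt (flatFrame s Γ r)
      (fun i => PowerSeries.coeff r (PowerSeries.X * (PowerSeries.mk (fun u => Γ i u x) *
        PowerSeries.mk fun m => flatFrame s Γ m x))) x := by
  obtain ⟨dΓ, hd, hflat0, hflat1⟩ := hflat
  have hΓs : ∀ i u, FiniteSpan (Γ i u) := by
    intro i u
    obtain ⟨n, f, v, -, hf⟩ := hΓ i u
    rw [funext hf]
    exact finiteSpan_sum_smul f v
  induction r using Nat.strong_induction_on with
  | _ r ih =>
    rcases r with _ | r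
    · simp only [flatFrame, PowerSeries.coeff_zero_X_mul]
      exact ⟨⟨Submodule.span ℂ {1}, Submodule.fg_span_singleton 1, fun _ =>
        Submodule.mem_span_singleton_self 1⟩, fun x _ => hasWeakFDerivAt_const 1 x⟩
    · simp only [PowerSeries.coeff_succ_X_mul, PowerSeries.coeff_mk_mul_mk]
      rw [flatFrame]
      simp only [Finset.sum_range fun u => Γ _ u _ * flatFrame s Γ (r - u) _]
      refine weakPrimitive_spec (exists_hasWeakFDerivAt_of_symmetric hs hso
        (B := fun i j x => ∑ u : Fin (r + 1), (dΓ j i u x * flatFrame s Γ (r - u) x + Γ i u x *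
          PowerSeries.coeff (r - u) (PowerSeries.X * (PowerSeries.mk (fun u => Γ j u x) *
            PowerSeries.mk fun m => flatFrame s Γ m x)))) (fun i => ?_) (fun i x hx => ?_)
        fun i j x hx => ?_)
      · exact FiniteSpan.sum fun u _ => (hΓs i u).mul (ih _ (by omega)).1
      · refine HasWeakFDerivAt.sum fun u _ => ?_
        exact (PartialOf.hasWeakFDerivAt hU (fun j => hd j i u) (hsU hx)).mul
          ((ih _ (by omega)).2 x hx) (hΓs i u) (ih _ (by omega)).1
      · let G : Fin N → PowerSeries 𝒜 := fun i => PowerSeries.mk fun u => Γ i u x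
        let F : PowerSeries 𝒜 := PowerSeries.mk fun m => flatFrame s Γ m x
        let dG : Fin N → Fin N → PowerSeries 𝒜 := fun j i => PowerSeries.mk fun u => dΓ j i u x
        have hcoeff : ∀ i j, (∑ u : Fin (r + 1), (dΓ j i u x * flatFrame s Γ (r - u) x +
            Γ i u x * PowerSeries.coeff (r - u) (PowerSeries.X * (G j * F)))) =
            PowerSeries.coeff r (dG j i * F + G i * (PowerSeries.X * (G j * F))) := by
          intro i j
          rw [map_add, PowerSeries.coeff_mk_mul_mk, PowerSeries.coeff_mul _ (G i),
            Finset.Nat.sum_antidiagonal_eq_sum_range_succ_mk, ← Finset.sum_add_distrib,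
            Finset.sum_range]
          simp [G]
        refine (hcoeff i j).trans (Eq.trans ?_ (hcoeff j i).symm)
        rw [flat_series_symm (G i) (G j) (dG j i) (dG i j) F]
        ext m
        rcases m with _ | m
        · simpa [dG] using hflat0 i j x (hsU hx)
        · have := hflat1 i j m x (hsU hx)
          rw [Finset.sum_sub_distrib] at this
          simpa [dG, G, PowerSeries.coeff_succ_X_mul, PowerSeries.coeff_mk_mul_mk] using this

/-- The parallel transport along a path is the difference of a flat frame between its ends. -/
theorem IsFundSol.eq_frame {s : Set (Fin N → ℝ)}
    {Γ : Fin N → ℕ → (Fin N → ℝ) → 𝒜}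
    {F : ℕ → (Fin N → ℝ) → 𝒜} (hF0 : ∀ x, F 0 x = 1)
    (hF : ∀ r, ∀ x ∈ s, HasWeakFDerivAt (F r)
      (fun i => PowerSeries.coeff r (PowerSeries.X * (PowerSeries.mk (fun u => Γ i u x) *
        PowerSeries.mk fun m => F m x))) x)
    {D : Set ℝ} (hD : D.Finite) {c : ℝ → Fin N → ℝ} (hc : PWPath 0 1 D c)
    (hcs : Set.MapsTo c (Set.Icc 0 1) s) {W : ℕ → ℝ → 𝒜}
    (hW : IsFundSol 0 1 0 D (pathField Γ c) onePS W) {t : ℝ} (ht : t ∈ Set.Icc (0 : ℝ) 1) :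
    seriesAt W t = (PowerSeries.mk fun m => F m (c t)) *
      PowerSeries.invOfUnit (PowerSeries.mk fun m => F m (c 0)) 1 := by
  set K := PowerSeries.invOfUnit (PowerSeries.mk fun m => F m (c 0)) 1 with hK
  let Z : ℝ → PowerSeries 𝒜 := fun t => (PowerSeries.mk fun m => F m (c t)) * K
  have hZ0 : Z 0 = 1 := PowerSeries.mul_invOfUnit _ _ (by simp [hF0])
  have hZcoeff : ∀ r t, PowerSeries.coeff r (Z t) =
      ∑ u ∈ Finset.range (r + 1), F u (c t) * PowerSeries.coeff (r - u) K := by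
    intro r t
    rw [PowerSeries.coeff_mul, Finset.Nat.sum_antidiagonal_eq_sum_range_succ_mk]
    simp
  -- composition of a frame component with a functional and right multiplication
  have hcomp : ∀ (φ : Module.Dual ℂ 𝒜) (a : 𝒜) (r : ℕ), ∀ x ∈ s,
      HasFDerivAt (fun y => φ (F r y * a)) (coordForm fun i =>
        φ (PowerSeries.coeff r (PowerSeries.X * (PowerSeries.mk (fun u => Γ i u x) *
        PowerSeries.mk fun m => F m x)) * a)) x :=
    fun φ a r x hx => hF r x hx (φ ∘ₗ LinearMap.mulRight ℂ a)
  have hcont : ∀ (φ : Module.Dual ℂ 𝒜) r,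
      ContinuousOn (fun t => φ (PowerSeries.coeff r (Z t))) (Set.Icc 0 1) := by
    intro φ r
    simp only [hZcoeff, map_sum]
    refine continuousOn_finsetSum _ fun u _ t ht => ?_
    exact ContinuousAt.comp_continuousWithinAt (g := fun y => φ (F u y * _))
      (hcomp φ _ u _ (hcs ht)).continuousAt (hc.1 t ht)
  have hderiv : ∀ (φ : Module.Dual ℂ 𝒜) r, ∀ t ∈ Set.Ioo (0 : ℝ) 1 \ D,
      HasDerivAt (fun t => φ (PowerSeries.coeff r (Z t)))
        (φ (PowerSeries.coeff r (PowerSeries.X *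
          (PowerSeries.mk (fun u => pathField Γ c u t) * Z t)))) t := by
    intro φ r t ht
    have hts : c t ∈ s := hcs (Set.Ioo_subset_Icc_self ht.1)
    have hnhds : Set.Icc (0 : ℝ) 1 \ D ∈ 𝓝 t :=
      mem_of_superset ((isOpen_Ioo.sdiff hD.isClosed).mem_nhds ht)
        (Set.sdiff_subset_sdiff_left Set.Ioo_subset_Icc_self)
    have hct : HasDerivAt c (fun i => deriv (fun t => c t i) t) t :=
      hasDerivAt_pi.2 fun i =>
        (((hc.2 i).1.contDiffAt hnhds).differentiableAt (by simp)).hasDerivAt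
    have h1 : HasDerivAt (fun t => φ (PowerSeries.coeff r (Z t)))
        (∑ u ∈ Finset.range (r + 1), (coordForm fun i =>
          φ (PowerSeries.coeff u (PowerSeries.X * (PowerSeries.mk (fun u => Γ i u (c t)) *
          PowerSeries.mk fun m => F m (c t))) * PowerSeries.coeff (r - u) K))
          (fun i => deriv (fun t => c t i) t)) t := by
      simp only [hZcoeff, map_sum]
      refine HasDerivAt.fun_sum fun u _ => ?_
      exact (hcomp φ _ u _ hts).comp_hasDerivAt t hct
    convert h1 using 1
    have hpf : (PowerSeries.mk fun u => pathField Γ c u t) =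
        ∑ i, ((deriv (fun t => c t i) t : ℝ) : ℂ) • PowerSeries.mk fun u => Γ i u (c t) := by
      ext u
      simp [pathField, map_sum]
    have hsum : ∀ P : PowerSeries 𝒜, PowerSeries.coeff r (P * K) =
        ∑ u ∈ Finset.range (r + 1), PowerSeries.coeff u P * PowerSeries.coeff (r - u) K := by
      intro P
      rw [PowerSeries.coeff_mul, Finset.Nat.sum_antidiagonal_eq_sum_range_succ_mk]
    simp only [Z, ← mul_assoc]
    rw [hsum, map_sum]
    refine Finset.sum_congr rfl fun u _ => ?_
    rw [coordForm_apply, hpf, Finset.mul_sum, Finset.sum_mul, map_sum, Finset.sum_mul, map_sum]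
    refine Finset.sum_congr rfl fun i _ => ?_
    have hsmul : ∀ (z : ℂ) (P : PowerSeries 𝒜),
        PowerSeries.coeff u (z • P) = z • PowerSeries.coeff u P := fun _ _ => rfl
    rw [mul_smul_comm, smul_mul_assoc, hsmul, smul_mul_assoc, map_smul, mul_assoc,
      Complex.real_smul, smul_eq_mul]
  have hmain : ∀ r, ∀ t ∈ Set.Icc (0 : ℝ) 1, W r t = PowerSeries.coeff r (Z t) := by
    intro r
    induction r using Nat.strong_induction_on with
    | _ r ih =>
      intro t ht
      rcases r with _ | r
      · have hK0 : PowerSeries.constantCoeff K = 1 := by simp [hK]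
        rw [hW.2.1 t ht, hZcoeff]
        simp [onePS, hF0, hK0]
      · obtain ⟨G, ⟨n, f, v, hfi, hf, hG⟩, hWG⟩ := hW.2.2 r
        refine eq_of_forall_dual fun φ => ?_
        have hint : ∀ k ∈ Finset.univ,
            IntervalIntegrable (fun y => f k y * φ (v k)) volume 0 t :=
          fun k _ => (hfi k t ht).mul_const _
        have hFTC := integral_eq_of_hasDerivAt_off_countable_of_le
          (fun t => φ (PowerSeries.coeff (r + 1) (Z t))) (fun y => ∑ k, f k y * φ (v k)) ht.1
          hD.countable ((hcont φ (r + 1)).mono (Set.Icc_subset_Icc_right ht.2))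
          (fun y hy => ?_) (by simpa only [Finset.sum_fn] using IntervalIntegrable.sum _ hint)
        · rw [intervalIntegral.integral_finsetSum hint, hZ0] at hFTC
          have hone : PowerSeries.coeff (r + 1) (1 : PowerSeries 𝒜) = 0 := by
            simp [PowerSeries.coeff_one]
          rw [hone, map_zero, sub_zero] at hFTC
          rw [hWG t ht, hG t ht, ← hFTC]
          simp [onePS]
        · have hy' : y ∈ Set.Ioo (0 : ℝ) 1 := ⟨hy.1.1, hy.1.2.trans_le ht.2⟩
          refine (hderiv φ (r + 1) y ⟨hy', hy.2⟩).congr_deriv ?_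
          symm
          have h2 := congrArg φ (hf y)
          simp only [map_sum, map_smul, smul_eq_mul] at h2
          rw [← h2, PowerSeries.coeff_succ_X_mul, PowerSeries.coeff_mul,
            Finset.Nat.sum_antidiagonal_eq_sum_range_succ_mk, map_sum]
          refine Finset.sum_congr rfl fun u _ => ?_
          rw [ih (r - u) (by omega) y (Set.Ioo_subset_Icc_self hy'), PowerSeries.coeff_mk]
  ext r
  rw [seriesAt, PowerSeries.coeff_mk]
  exact hmain r t ht

end FlatFrame

/-- For a flat formal connection, parallel transports along two
continuous piecewise `C^∞` paths with the same endpoints contained in a star-shaped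
open subset coincide; in particular the parallel transport along any continuous
piecewise `C^∞` loop contained in the star-shaped subset equals `1`. -/
theorem statement13 {𝒜 : Type u} [Ring 𝒜] [Algebra ℂ 𝒜] {N : ℕ}
    (U : Set (Fin N → ℝ)) (hUopen : IsOpen U) (hUne : U.Nonempty)
    (Γ : Fin N → ℕ → (Fin N → ℝ) → 𝒜) (hΓ : IsFormalConn U Γ) (hflat : IsFlat U Γ)
    (U' : Set (Fin N → ℝ)) (hU'open : IsOpen U') (hU'sub : U' ⊆ U)
    (ϖ : Fin N → ℝ) (hϖ : ϖ ∈ U')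
    (hstar : ∀ x ∈ U', ∀ t ∈ Set.Icc (0 : ℝ) 1, (1 - t) • x + t • ϖ ∈ U')
    (D₁ D₂ : Set ℝ) (hD₁fin : D₁.Finite) (hD₂fin : D₂.Finite)
    (h0D₁ : (0 : ℝ) ∈ D₁) (h1D₁ : (1 : ℝ) ∈ D₁) (hD₁sub : D₁ ⊆ Set.Icc 0 1)
    (h0D₂ : (0 : ℝ) ∈ D₂) (h1D₂ : (1 : ℝ) ∈ D₂) (hD₂sub : D₂ ⊆ Set.Icc 0 1)
    (c₁ c₂ : ℝ → Fin N → ℝ) (hc₁ : PWPath 0 1 D₁ c₁) (hc₂ : PWPath 0 1 D₂ c₂)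
    (hc₁U' : Set.MapsTo c₁ (Set.Icc 0 1) U') (hc₂U' : Set.MapsTo c₂ (Set.Icc 0 1) U')
    (hinit : c₁ 0 = c₂ 0) (hfin : c₁ 1 = c₂ 1)
    (W₁ W₂ : ℕ → ℝ → 𝒜)
    (hW₁ : IsFundSol 0 1 0 D₁ (pathField Γ c₁) onePS W₁)
    (hW₂ : IsFundSol 0 1 0 D₂ (pathField Γ c₂) onePS W₂) :
    seriesAt W₁ 1 = seriesAt W₂ 1 ∧
    ∀ (D₃ : Set ℝ) (c₃ : ℝ → Fin N → ℝ) (W₃ : ℕ → ℝ → 𝒜),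
      D₃.Finite → (0 : ℝ) ∈ D₃ → (1 : ℝ) ∈ D₃ → D₃ ⊆ Set.Icc 0 1 →
      PWPath 0 1 D₃ c₃ → Set.MapsTo c₃ (Set.Icc 0 1) U' → c₃ 0 = c₃ 1 →
      IsFundSol 0 1 0 D₃ (pathField Γ c₃) onePS W₃ →
      seriesAt W₃ 1 = 1 := by
  have hs : StarConvex ℝ ϖ U' := by
    intro x hx a b ha hb hab
    have h := hstar x hx a ⟨ha, by linarith⟩
    rwa [show (1 : ℝ) - a = b by linarith, add_comm] at h
  have hF := fun r => (hasWeakFDerivAt_flatFrame hUopen hU'sub hU'open hs hΓ hflat r).2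
  have hF0 : ∀ x, flatFrame U' Γ 0 x = 1 := fun x => by simp [flatFrame]
  have h1 : (1 : ℝ) ∈ Set.Icc (0 : ℝ) 1 := by simp
  refine ⟨?_, fun D₃ c₃ W₃ hD₃ _ _ _ hc₃ hc₃U' hloop hW₃ => ?_⟩
  · rw [IsFundSol.eq_frame hF0 hF hD₁fin hc₁ hc₁U' hW₁ h1,
      IsFundSol.eq_frame hF0 hF hD₂fin hc₂ hc₂U' hW₂ h1, hinit, hfin]
  · rw [IsFundSol.eq_frame hF0 hF hD₃ hc₃ hc₃U' hW₃ h1, ← hloop]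
    exact PowerSeries.mul_invOfUnit _ _ (by simp [hF0])
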